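/- arXiv:2111.09404 — 9 statements merged into one kernel-verified Lean document; each statement's English description precedes it below -/
import Mathlib

section
/- Let R be a subring of ℂ, let P be a free R-module of finite rank equipped with a symmetric R-bilinear form B : P × P → R, let T ⊆ P be an R-submodule, and let N = {x ∈ P : B(x,y) = 0 for all y ∈ P} be the radical of the form. Suppose that T is self-dual with respect to B, i.e. the R-linear map T → Hom_R(T,R) sending t to the functional s ↦ B(t,s) is an isomorphism, and suppose that inside the complexification P ⊗_R ℂ the ℂ-spans of (the images of) T and N form a direct sum decomposition: span_ℂ(T) ∩ span_ℂ(N) = 0 and span_ℂ(T) + span_ℂ(N) = P ⊗_R ℂ. Then P is the internal direct sum of T and N: T ∩ N = 0 and T + N = P. -/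
open TensorProduct in
/-- **Splitting off the radical against a self-dual submodule.**
`R` is a subring of `ℂ`, `P` a free `R`-module of finite rank with a symmetric `R`-bilinear
form `B`, `T ⊆ P` a submodule and `N` the radical of `B`.  If `T` is self-dual with respect
to `B` (the map `T → Hom_R(T, R)`, `t ↦ B t ·`, is bijective) and in the complexification
`ℂ ⊗[R] P` the ℂ-spans of the images of `T` and `N` form a direct sum decomposition, then
`P` is the internal direct sum of `T` and `N`. -/
theorem self_dual_submodule_splits_off_radical
    (R : Subring ℂ) (P : Type*) [AddCommGroup P] [Module R P]
    [Module.Free R P] [Module.Finite R P]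
    (B : P →ₗ[R] P →ₗ[R] R)
    (hsymm : ∀ x y : P, B x y = B y x)
    (T N : Submodule R P)
    (hN : ∀ x : P, x ∈ N ↔ ∀ y : P, B x y = 0)
    (hdual : Function.Bijective fun t : T => (B (t : P)).domRestrict T)
    (hinf : Submodule.span ℂ ((TensorProduct.mk R ℂ P 1) '' (T : Set P)) ⊓
        Submodule.span ℂ ((TensorProduct.mk R ℂ P 1) '' (N : Set P)) = ⊥)
    (hsup : Submodule.span ℂ ((TensorProduct.mk R ℂ P 1) '' (T : Set P)) ⊔
        Submodule.span ℂ ((TensorProduct.mk R ℂ P 1) '' (N : Set P)) = ⊤) :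
    T ⊓ N = ⊥ ∧ T ⊔ N = ⊤ := by
  refine ⟨(Submodule.eq_bot_iff _).2 ?_, eq_top_iff.2 fun x _ => ?_⟩
  · rintro t ⟨htT, htN⟩
    have h : (⟨t, htT⟩ : T) = 0 := hdual.1 <| by
      ext s
      simp [(hN t).1 htN]
    exact congrArg Subtype.val h
  · obtain ⟨t, ht⟩ := hdual.2 ((B x).domRestrict T)
    have hT : ∀ s ∈ T, B (x - t) s = 0 := fun s hs => by
      have h : B (t : P) s = B x s := LinearMap.congr_fun ht ⟨s, hs⟩
      simp [h]
    have hyN : ∀ s ∈ N, B (x - t) s = 0 := fun s hs => by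
      rw [hsymm, (hN s).1 hs]
    let φ : ℂ ⊗[R] P →ₗ[ℂ] ℂ :=
      LinearMap.liftBaseChange ℂ ((Algebra.linearMap R ℂ).comp (B (x - t)))
    have hφ : ∀ z : P, φ (1 ⊗ₜ z) = (B (x - t) z : ℂ) := fun z =>
      (LinearMap.liftBaseChange_tmul _ _ _ _).trans (one_smul _ _)
    have hker : LinearMap.ker φ = ⊤ := by
      rw [eq_top_iff, ← hsup]
      refine sup_le (Submodule.span_le.2 ?_) (Submodule.span_le.2 ?_)
      · rintro _ ⟨s, hs, rfl⟩
        exact (hφ s).trans (by rw [hT s hs]; rfl)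
      · rintro _ ⟨s, hs, rfl⟩
        exact (hφ s).trans (by rw [hyN s hs]; rfl)
    have hmem : x - t ∈ N := (hN _).2 fun z => Subtype.ext <| by
      rw [← hφ z, LinearMap.ker_eq_top.1 hker]
      rfl
    exact Submodule.mem_sup.2 ⟨t, t.2, x - t, hmem, add_sub_cancel _ _⟩
end

section
/- Let S be the commutative ring presented as the quotient of the polynomial ring ℤ[B,C,D,E,CA,CB,CE,CAB] by the ideal generated by the elements B²−1, B·C−C, B·D−D, B·E−E, B·CA−CB, B·CB−CA, B·CE−CE, B·CAB−CAB, C²−2E, C·D−2D, C·E−2C, C·CA−D−E, C·CB−D−E, C·CE−C−D−E, C·CAB−C−D−E, D²−4D, D·E−2D, D·CA−3D, D·CB−3D, D·CE−4D, D·CAB−4D, E²−2E, E·CA−C−D, E·CB−C−D, E·CE−C−D−E, E·CAB−C−D−E, CA²−1−2D, CA·CB−B−2D, CA·CE−CAB−2D, CA·CAB−CE−2D, CB²−1−2D, CB·CE−CAB−2D, CB·CAB−CE−2D, CE²−CE−CAB−2D, CE·CAB−CE−CAB−2D, CAB²−CE−CAB−2D. Then a map φ : S → ℂ is a ring homomorphism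 if and only if the tuple (φ(B), φ(C), φ(D), φ(E), φ(CA), φ(CB), φ(CE), φ(CAB)) is one of the following eight tuples: (1,2,4,2,3,3,4,4), (1,−2,0,2,−1,−1,0,0), (1,2,0,2,1,1,2,2), (−1,0,0,0,1,−1,0,0), (−1,0,0,0,−1,1,0,0), (1,0,0,0,1,1,0,0), (1,0,0,0,−1,−1,0,0), (1,0,0,0,1,1,2,2). In particular there are exactly eight ring homomorphisms S → ℂ, and every such homomorphism takes values in the integers. -/
open MvPolynomial

/-- The defining relations of the Green ring of `ℤ[ℤ/4ℤ]`, in the variables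
`B = X 0`, `C = X 1`, `D = X 2`, `E = X 3`, `C^A = X 4`, `C^B = X 5`, `C^E = X 6`,
`C^{AB} = X 7` (the unit corresponds to the trivial module `A`).  These encode the
tensor-product multiplication table of Roiter's nine indecomposable
`ℤ`-free `ℤ[ℤ/4ℤ]`-modules. -/
noncomputable def greenRelations4 : Set (MvPolynomial (Fin 8) ℤ) :=
  { X 0 ^ 2 - 1, X 0 * X 1 - X 1, X 0 * X 2 - X 2, X 0 * X 3 - X 3,
    X 0 * X 4 - X 5, X 0 * X 5 - X 4, X 0 * X 6 - X 6, X 0 * X 7 - X 7,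
    X 1 ^ 2 - 2 * X 3, X 1 * X 2 - 2 * X 2, X 1 * X 3 - 2 * X 1,
    X 1 * X 4 - X 2 - X 3, X 1 * X 5 - X 2 - X 3,
    X 1 * X 6 - X 1 - X 2 - X 3, X 1 * X 7 - X 1 - X 2 - X 3,
    X 2 ^ 2 - 4 * X 2, X 2 * X 3 - 2 * X 2, X 2 * X 4 - 3 * X 2, X 2 * X 5 - 3 * X 2,
    X 2 * X 6 - 4 * X 2, X 2 * X 7 - 4 * X 2,
    X 3 ^ 2 - 2 * X 3, X 3 * X 4 - X 1 - X 2, X 3 * X 5 - X 1 - X 2,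
    X 3 * X 6 - X 1 - X 2 - X 3, X 3 * X 7 - X 1 - X 2 - X 3,
    X 4 ^ 2 - 1 - 2 * X 2, X 4 * X 5 - X 0 - 2 * X 2,
    X 4 * X 6 - X 7 - 2 * X 2, X 4 * X 7 - X 6 - 2 * X 2,
    X 5 ^ 2 - 1 - 2 * X 2, X 5 * X 6 - X 7 - 2 * X 2, X 5 * X 7 - X 6 - 2 * X 2,
    X 6 ^ 2 - X 6 - X 7 - 2 * X 2, X 6 * X 7 - X 6 - X 7 - 2 * X 2,
    X 7 ^ 2 - X 6 - X 7 - 2 * X 2 }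

/-- The ideal of relations of the Green ring of `ℤ[ℤ/4ℤ]`. -/
noncomputable def greenIdeal4 : Ideal (MvPolynomial (Fin 8) ℤ) :=
  Ideal.span greenRelations4

/-- The Green ring of `ℤ[ℤ/4ℤ]`, presented by generators
`B, C, D, E, C^A, C^B, C^E, C^{AB}` and the tensor-product relations. -/
noncomputable abbrev GreenRing4 : Type :=
  MvPolynomial (Fin 8) ℤ ⧸ greenIdeal4

/-- The class of the `i`-th indecomposable generator in the Green ring of `ℤ[ℤ/4ℤ]`. -/
noncomputable def greenGen4 (i : Fin 8) : GreenRing4 :=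
  Ideal.Quotient.mk greenIdeal4 (X i)

/-- The eight value-tuples on `(B, C, D, E, C^A, C^B, C^E, C^{AB})` of the ring
homomorphisms from the Green ring of `ℤ[ℤ/4ℤ]` to `ℂ`. -/
def greenTuples4 : Set (Fin 8 → ℂ) :=
  { ![1, 2, 4, 2, 3, 3, 4, 4], ![1, -2, 0, 2, -1, -1, 0, 0],
    ![1, 2, 0, 2, 1, 1, 2, 2], ![-1, 0, 0, 0, 1, -1, 0, 0],
    ![-1, 0, 0, 0, -1, 1, 0, 0], ![1, 0, 0, 0, 1, 1, 0, 0],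
    ![1, 0, 0, 0, -1, -1, 0, 0], ![1, 0, 0, 0, 1, 1, 2, 2] }

/-- The relations of the Green ring of `ℤ[ℤ/4ℤ]`, evaluated at a point of `ℂ⁸`, vanish exactly at
the eight listed tuples. -/
theorem greenRelations4_eval₂_eq_zero_iff (t : Fin 8 → ℂ) :
    (∀ p ∈ greenRelations4, eval₂Hom (Int.castRingHom ℂ) t p = 0) ↔ t ∈ greenTuples4 := by
  constructor
  · intro h
    simp only [greenRelations4, Set.forall_mem_insert, Set.mem_singleton_iff, forall_eq, map_sub,
      map_mul, map_pow, map_one, map_ofNat, eval₂Hom_X'] at h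
    obtain ⟨hBB, hBC, hBD, hBE, hBA, -, hB6, hB7, hCC, hCD, -, hCA, -, hC6, hC7,
      hDD, hDE, hDA, -, hD6, hD7, hEE, hEA, -, -, -, hAA, -, hA6, -, -, -, -, h66, -, -⟩ := h
    have key : ∀ s : Fin 8 → ℂ, t 0 = s 0 → t 1 = s 1 → t 2 = s 2 → t 3 = s 3 → t 4 = s 4 →
        t 5 = s 5 → t 6 = s 6 → t 7 = s 7 → t = s := by
      intro s h0 h1 h2 h3 h4 h5 h6 h7
      ext i
      fin_cases i <;> assumption
    simp only [greenTuples4, Set.mem_insert_iff, Set.mem_singleton_iff]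
    rcases sq_eq_one_iff.mp (sub_eq_zero.mp hBB) with hB | hB
    · rcases mul_eq_zero.mp (show t 2 * (t 2 - 4) = 0 by linear_combination hDD) with hD | hD
      · rcases sq_eq_one_iff.mp (show t 4 ^ 2 = 1 by linear_combination hAA + 2 * hD) with hA | hA
        · rcases mul_eq_zero.mp (show t 3 * (t 3 - 2) = 0 by linear_combination hEE) with hE | hE
          · rcases mul_eq_zero.mp (show t 6 * (t 6 - 2) = 0 by grind) with h6 | h6
            · exact .inr <| .inr <| .inr <| .inr <| .inr <| .inl <| by
                apply key <;> simp <;> grind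
            · exact .inr <| .inr <| .inr <| .inr <| .inr <| .inr <| .inr <| by
                apply key <;> simp <;> grind
          · exact .inr <| .inr <| .inl <| by
              apply key <;> simp <;> grind
        · rcases mul_eq_zero.mp (show t 3 * (t 3 - 2) = 0 by linear_combination hEE) with hE | hE
          · exact .inr <| .inr <| .inr <| .inr <| .inr <| .inr <| .inl <| by
              apply key <;> simp <;> grind
          · exact .inr <| .inl <| by
              apply key <;> simp <;> grind
      · exact .inl <| by
          apply key <;> simp <;> grind
    · rcases sq_eq_one_iff.mp (show t 4 ^ 2 = 1 by grind) with hA | hA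
      · exact .inr <| .inr <| .inr <| .inl <| by
          apply key <;> simp <;> grind
      · exact .inr <| .inr <| .inr <| .inr <| .inl <| by
          apply key <;> simp <;> grind
  · intro h
    simp only [greenTuples4, Set.mem_insert_iff, Set.mem_singleton_iff] at h
    simp only [greenRelations4, Set.forall_mem_insert, Set.mem_singleton_iff, forall_eq, map_sub,
      map_mul, map_pow, map_one, map_ofNat, eval₂Hom_X']
    rcases h with rfl | rfl | rfl | rfl | rfl | rfl | rfl | rfl <;>
      simp [Fin.isValue] <;> norm_num

/-- The values of a ring homomorphism from the Green ring of `ℤ[ℤ/4ℤ]` at the generators form one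
of the eight listed tuples. -/
theorem ringHom_greenGen4_mem (φ : GreenRing4 →+* ℂ) :
    (fun i => φ (greenGen4 i)) ∈ greenTuples4 := by
  rw [← greenRelations4_eval₂_eq_zero_iff]
  have hcomp : eval₂Hom (Int.castRingHom ℂ) (fun i => φ (greenGen4 i)) =
      φ.comp (Ideal.Quotient.mk greenIdeal4) := by
    ext i <;> simp [greenGen4]
  intro p hp
  have hp' : p ∈ greenIdeal4 := Ideal.subset_span hp
  rw [hcomp, RingHom.comp_apply, Ideal.Quotient.eq_zero_iff_mem.mpr hp', map_zero]

/-- A ring homomorphism on the Green ring of `ℤ[ℤ/4ℤ]` is determined by its values at the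
generators. -/
theorem GreenRing4.ringHom_ext {R : Type*} [CommRing R] {φ ψ : GreenRing4 →+* R}
    (h : ∀ i, φ (greenGen4 i) = ψ (greenGen4 i)) : φ = ψ := by
  refine Ideal.Quotient.ringHom_ext (MvPolynomial.ringHom_ext (fun n => ?_) h)
  simp

/-- Every coordinate of each of the eight tuples is an integer. -/
theorem exists_int_of_mem_greenTuples4 {t : Fin 8 → ℂ} (ht : t ∈ greenTuples4) :
    ∃ z : Fin 8 → ℤ, t = fun i => (z i : ℂ) := by
  simp only [greenTuples4, Set.mem_insert_iff, Set.mem_singleton_iff] at ht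
  rcases ht with rfl | rfl | rfl | rfl | rfl | rfl | rfl | rfl
  on_goal 1 => use ![1, 2, 4, 2, 3, 3, 4, 4]
  on_goal 2 => use ![1, -2, 0, 2, -1, -1, 0, 0]
  on_goal 3 => use ![1, 2, 0, 2, 1, 1, 2, 2]
  on_goal 4 => use ![-1, 0, 0, 0, 1, -1, 0, 0]
  on_goal 5 => use ![-1, 0, 0, 0, -1, 1, 0, 0]
  on_goal 6 => use ![1, 0, 0, 0, 1, 1, 0, 0]
  on_goal 7 => use ![1, 0, 0, 0, -1, -1, 0, 0]
  on_goal 8 => use ![1, 0, 0, 0, 1, 1, 2, 2]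
  all_goals
    ext i
    fin_cases i <;> simp

/-- **Classification of ring homomorphisms from the Green ring of `ℤ[ℤ/4ℤ]` to `ℂ`.**
A map `φ : GreenRing4 → ℂ` is a ring homomorphism if and only if the tuple of values
`(φ B, φ C, φ D, φ E, φ C^A, φ C^B, φ C^E, φ C^{AB})` is one of the eight listed tuples;
each such tuple comes from exactly one ring homomorphism, and every ring homomorphism
takes values in the integers. -/
theorem greenRing4_ringHom_classification :
    (∀ φ : GreenRing4 →+* ℂ, (fun i => φ (greenGen4 i)) ∈ greenTuples4) ∧
    (∀ t ∈ greenTuples4, ∃! φ : GreenRing4 →+* ℂ, (fun i => φ (greenGen4 i)) = t) ∧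
    (∀ φ : GreenRing4 →+* ℂ, ∀ x : GreenRing4, ∃ n : ℤ, φ x = (n : ℂ)) := by
  refine ⟨ringHom_greenGen4_mem, fun t ht => ?_, fun φ x => ?_⟩
  · have hI : ∀ p ∈ greenIdeal4, eval₂Hom (Int.castRingHom ℂ) t p = 0 := fun p hp =>
      (Ideal.span_le (I := RingHom.ker (eval₂Hom (Int.castRingHom ℂ) t))).mpr
        ((greenRelations4_eval₂_eq_zero_iff t).mpr ht) hp
    refine ⟨Ideal.Quotient.lift greenIdeal4 _ hI, ?_, fun ψ hψ => ?_⟩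
    · ext i
      simp [greenGen4]
    · refine GreenRing4.ringHom_ext fun i => ?_
      rw [show ψ (greenGen4 i) = t i from congrFun hψ i]
      simp [greenGen4]
  · obtain ⟨z, hz⟩ := exists_int_of_mem_greenTuples4 (ringHom_greenGen4_mem φ)
    have hcomp : φ.comp (Ideal.Quotient.mk greenIdeal4) =
        (Int.castRingHom ℂ).comp (eval₂Hom (RingHom.id ℤ) z) := by
      ext i
      · simp
      · simpa [greenGen4] using congrFun hz i
    obtain ⟨p, rfl⟩ := Ideal.Quotient.mk_surjective x
    exact ⟨_, DFunLike.congr_fun hcomp p⟩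
end

section
/- A map φ : ℤ[d,c]/(d²−4d, c²−2d−1, (c−3)d) → ℂ is a ring homomorphism if and only if (φ(d), φ(c)) is one of the three pairs (4,3), (0,1), (0,−1). In particular there are exactly three ring homomorphisms from ℤ[d,c]/(d²−4d, c²−2d−1, (c−3)d) to ℂ, and all of them take values in the integers. -/
open MvPolynomial

/-- The ideal `(d² − 4d, c² − 2d − 1, (c − 3)d)` of `ℤ[d, c]`, with `d = X 0`, `c = X 1`.
The quotient is the subring of the Green ring of `ℤ[ℤ/4ℤ]` generated by the indecomposable
modules appearing in `V^♮_ℤ` under a cyclic group generated by a 4A element. -/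
noncomputable def ideal4A : Ideal (MvPolynomial (Fin 2) ℤ) :=
  Ideal.span {X 0 ^ 2 - 4 * X 0, X 1 ^ 2 - 2 * X 0 - 1, (X 1 - 3) * X 0}

/-- The ring `ℤ[d, c]/(d² − 4d, c² − 2d − 1, (c − 3)d)`. -/
noncomputable abbrev Ring4A : Type :=
  MvPolynomial (Fin 2) ℤ ⧸ ideal4A

theorem ideal4A_eval₂_eq_zero {R : Type*} [CommRing R] (d c : R) (hd : d ^ 2 = 4 * d)
    (hc : c ^ 2 = 2 * d + 1) (hcd : (c - 3) * d = 0) :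
    ∀ p ∈ ideal4A, eval₂Hom (Int.castRingHom R) ![d, c] p = 0 := by
  have hle : ideal4A ≤ RingHom.ker (eval₂Hom (Int.castRingHom R) ![d, c]) := by
    refine Ideal.span_le.2 ?_
    rintro p (rfl | rfl | rfl)
    · simp [RingHom.mem_ker, hd]
    · simp [RingHom.mem_ker, hc]
    · simpa [RingHom.mem_ker] using hcd
  exact fun p hp => hle hp

theorem Ring4A.exists_ringHom {R : Type*} [CommRing R] (d c : R) (hd : d ^ 2 = 4 * d)
    (hc : c ^ 2 = 2 * d + 1) (hcd : (c - 3) * d = 0) :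
    ∃ φ : Ring4A →+* R, φ (Ideal.Quotient.mk ideal4A (X 0)) = d ∧
      φ (Ideal.Quotient.mk ideal4A (X 1)) = c :=
  ⟨Ideal.Quotient.lift ideal4A _ (ideal4A_eval₂_eq_zero d c hd hc hcd), by simp, by simp⟩

theorem Ring4A.ringHom_ext {R : Type*} [CommRing R] {φ ψ : Ring4A →+* R}
    (hd : φ (Ideal.Quotient.mk ideal4A (X 0)) = ψ (Ideal.Quotient.mk ideal4A (X 0)))
    (hc : φ (Ideal.Quotient.mk ideal4A (X 1)) = ψ (Ideal.Quotient.mk ideal4A (X 1))) :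
    φ = ψ := by
  refine Ideal.Quotient.ringHom_ext (MvPolynomial.ringHom_ext (fun n => by simp) fun i => ?_)
  fin_cases i
  · exact hd
  · exact hc

theorem Ring4A.relations :
    let d : Ring4A := Ideal.Quotient.mk ideal4A (X 0)
    let c : Ring4A := Ideal.Quotient.mk ideal4A (X 1)
    d ^ 2 - 4 * d = 0 ∧ c ^ 2 - 2 * d - 1 = 0 ∧ (c - 3) * d = 0 := by
  have h (p : MvPolynomial (Fin 2) ℤ)
      (hp : p ∈ ({X 0 ^ 2 - 4 * X 0, X 1 ^ 2 - 2 * X 0 - 1, (X 1 - 3) * X 0} : Set _)) :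
      Ideal.Quotient.mk ideal4A p = 0 :=
    Ideal.Quotient.eq_zero_iff_mem.2 (Ideal.subset_span hp)
  exact ⟨h _ (Or.inl rfl), h _ (Or.inr (Or.inl rfl)),
    h _ (Or.inr (Or.inr rfl))⟩

theorem Ring4A.ringHom_values {R : Type*} [CommRing R] [IsDomain R] (φ : Ring4A →+* R) :
    (φ (Ideal.Quotient.mk ideal4A (X 0)), φ (Ideal.Quotient.mk ideal4A (X 1)))
      ∈ ({(4, 3), (0, 1), (0, -1)} : Set (R × R)) := by
  obtain ⟨h₁, h₂, h₃⟩ := Ring4A.relations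
  apply_fun φ at h₁ h₂ h₃
  simp only [map_sub, map_mul, map_pow, map_one, map_ofNat, map_zero] at h₁ h₂ h₃
  simp only [Set.mem_insert_iff, Set.mem_singleton_iff, Prod.mk.injEq]
  generalize φ (Ideal.Quotient.mk ideal4A (X 0)) = d at *
  generalize φ (Ideal.Quotient.mk ideal4A (X 1)) = c at *
  by_cases hd : d = 0
  · subst hd
    have hc : c ^ 2 = 1 := by linear_combination h₂
    exact Or.inr ((sq_eq_sq_iff_eq_or_eq_neg.1 (hc.trans (one_pow 2).symm)).imp (⟨rfl, ·⟩) (⟨rfl, ·⟩))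
  · left
    have hc : c - 3 = 0 := (mul_eq_zero.1 h₃).resolve_right hd
    have hd4 : d * (d - 4) = 0 := by linear_combination h₁
    exact ⟨sub_eq_zero.1 ((mul_eq_zero.1 hd4).resolve_left hd), sub_eq_zero.1 hc⟩

theorem Ring4A.exists_int_eq (φ : Ring4A →+* ℂ) (x : Ring4A) : ∃ n : ℤ, φ x = n := by
  obtain ⟨a, b, ha, hb⟩ : ∃ a b : ℤ, φ (Ideal.Quotient.mk ideal4A (X 0)) = a ∧
      φ (Ideal.Quotient.mk ideal4A (X 1)) = b := by
    rcases Ring4A.ringHom_values φ with h | h | h <;>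
      simp only [Set.mem_singleton_iff, Prod.mk.injEq] at h
    · exact ⟨4, 3, by simp [h.1], by simp [h.2]⟩
    · exact ⟨0, 1, by simp [h.1], by simp [h.2]⟩
    · exact ⟨0, -1, by simp [h.1], by simp [h.2]⟩
  obtain ⟨p, rfl⟩ := Ideal.Quotient.mk_surjective x
  induction p using MvPolynomial.induction_on with
  | C n => exact ⟨n, by simp⟩
  | add p q hp hq =>
    obtain ⟨m, hm⟩ := hp
    obtain ⟨n, hn⟩ := hq
    exact ⟨m + n, by simp [hm, hn]⟩
  | mul_X p i hp =>
    obtain ⟨m, hm⟩ := hp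
    fin_cases i
    · exact ⟨m * a, by simp [hm, ha]⟩
    · exact ⟨m * b, by simp [hm, hb]⟩

/-- **Classification of ring homomorphisms `ℤ[d,c]/(d²−4d, c²−2d−1, (c−3)d) → ℂ`.**
A map `φ` is a ring homomorphism if and only if `(φ d, φ c)` is one of `(4,3)`, `(0,1)`,
`(0,−1)`; there are exactly three such homomorphisms, each determined by its values on
`d` and `c`, and all take values in the integers. -/
theorem ring4A_ringHom_classification :
    (∀ φ : Ring4A →+* ℂ,
      (φ (Ideal.Quotient.mk ideal4A (X 0)), φ (Ideal.Quotient.mk ideal4A (X 1)))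
        ∈ ({(4, 3), (0, 1), (0, -1)} : Set (ℂ × ℂ))) ∧
    (∀ t ∈ ({(4, 3), (0, 1), (0, -1)} : Set (ℂ × ℂ)),
      ∃! φ : Ring4A →+* ℂ,
        (φ (Ideal.Quotient.mk ideal4A (X 0)), φ (Ideal.Quotient.mk ideal4A (X 1))) = t) ∧
    (∀ φ : Ring4A →+* ℂ, ∀ x : Ring4A, ∃ n : ℤ, φ x = (n : ℂ)) := by
  refine ⟨Ring4A.ringHom_values, fun t ht => ?_, Ring4A.exists_int_eq⟩
  obtain ⟨φ, hd, hc⟩ : ∃ φ : Ring4A →+* ℂ, φ (Ideal.Quotient.mk ideal4A (X 0)) = t.1 ∧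
      φ (Ideal.Quotient.mk ideal4A (X 1)) = t.2 := by
    apply Ring4A.exists_ringHom <;> rcases ht with rfl | rfl | rfl <;> norm_num
  refine ⟨φ, Prod.ext hd hc, fun ψ hψ => ?_⟩
  subst hψ
  exact Ring4A.ringHom_ext hd.symm hc.symm
end

section
/- Let S be the commutative ring presented as the quotient of the polynomial ring ℤ[B,C,D,E,CA,CB,CE,CAB] by the ideal generated by the elements B²−1, B·C−C, B·D−D, B·E−E, B·CA−CB, B·CB−CA, B·CE−CE, B·CAB−CAB, C²−2E, C·D−2D, C·E−2C, C·CA−D−E, C·CB−D−E, C·CE−C−D−E, C·CAB−C−D−E, D²−4D, D·E−2D, D·CA−3D, D·CB−3D, D·CE−4D, D·CAB−4D, E²−2E, E·CA−C−D, E·CB−C−D, E·CE−C−D−E, E·CAB−C−D−E, CA²−1−2D, CA·CB−B−2D, CA·CE−CAB−2D, CA·CAB−CE−2D, CB²−1−2D, CB·CE−CAB−2D, CB·CAB−CE−2D, CE²−CE−CAB−2D, CE·CAB−CE−CAB−2D, CAB²−CE−CAB−2D. Then the ring homomorphism ℤ[x,y]/(x²−4x, y²−2x−1, (y−3)x) →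 S determined by x ↦ D and y ↦ CA is well defined and injective, and its image is the subring of S generated by D and CA. -/
open MvPolynomial

theorem eval_greenRelations4_eq_zero {c y : ℤ} (hcc : c ^ 2 = 2 * c) (hcy : c * y = 3 * c)
    (hyy : y ^ 2 = 1 + 4 * c) {p : MvPolynomial (Fin 8) ℤ} (hp : p ∈ greenRelations4) :
    eval ![1, c, 2 * c, c, y, y, 2 * c, 2 * c] p = 0 := by
  revert p
  simp only [greenRelations4, Set.forall_mem_insert, Set.mem_singleton_iff, forall_eq, map_sub,
    map_mul, map_pow, map_one, map_ofNat, eval_X, Matrix.cons_val]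
  and_intros <;> grind

/-- A solution of `c² = 2c`, `cy = 3c`, `y² = 1 + 4c` gives an integer character of the
Green ring. -/
theorem exists_greenRing4_character {c y : ℤ} (hcc : c ^ 2 = 2 * c) (hcy : c * y = 3 * c)
    (hyy : y ^ 2 = 1 + 4 * c) :
    ∃ χ : GreenRing4 →+* ℤ, χ (greenGen4 2) = 2 * c ∧ χ (greenGen4 4) = y := by
  let v : Fin 8 → ℤ := ![1, c, 2 * c, c, y, y, 2 * c, 2 * c]
  have h : greenIdeal4 ≤ RingHom.ker (eval v) :=
    Ideal.span_le.2 fun _ => eval_greenRelations4_eq_zero hcc hcy hyy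
  exact ⟨Ideal.Quotient.lift greenIdeal4 (eval v) fun _ hp => RingHom.mem_ker.1 (h hp),
    (Ideal.Quotient.lift_mk _ _ _).trans (eval_X 2),
    (Ideal.Quotient.lift_mk _ _ _).trans (eval_X 4)⟩

/-- The classes of `1`, `D` and `C^A` are linearly independent over `ℤ`. -/
theorem greenGen4_combination_eq_zero {a b c : ℤ}
    (h : (a : GreenRing4) + b * greenGen4 2 + c * greenGen4 4 = 0) :
    a = 0 ∧ b = 0 ∧ c = 0 := by
  have key {t y : ℤ} (htt : t ^ 2 = 2 * t) (hty : t * y = 3 * t) (hyy : y ^ 2 = 1 + 4 * t) :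
      a + b * (2 * t) + c * y = 0 := by
    obtain ⟨χ, hd, he⟩ := exists_greenRing4_character htt hty hyy
    simpa only [map_add, map_mul, map_intCast, Int.cast_id, hd, he, map_zero] using congrArg χ h
  have h₁ := key (t := 2) (y := 3) (by norm_num) (by norm_num) (by norm_num)
  have h₂ := key (t := 0) (y := 1) (by norm_num) (by norm_num) (by norm_num)
  have h₃ := key (t := 0) (y := -1) (by norm_num) (by norm_num) (by norm_num)
  clear key h
  lia

theorem greenGen4_two_sq : greenGen4 2 ^ 2 - 4 * greenGen4 2 = 0 := by
  have h : Ideal.Quotient.mk greenIdeal4 (X 2 ^ 2 - 4 * X 2) = 0 :=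
    Ideal.Quotient.eq_zero_iff_mem.2 (Ideal.subset_span (by simp [greenRelations4]))
  simpa only [greenGen4, map_sub, map_mul, map_pow, map_ofNat] using h

theorem greenGen4_four_sq : greenGen4 4 ^ 2 - 2 * greenGen4 2 - 1 = 0 := by
  have h : Ideal.Quotient.mk greenIdeal4 (X 4 ^ 2 - 1 - 2 * X 2) = 0 :=
    Ideal.Quotient.eq_zero_iff_mem.2 (Ideal.subset_span (by simp [greenRelations4]))
  rw [sub_right_comm]
  simpa only [greenGen4, map_sub, map_mul, map_pow, map_ofNat, map_one] using h

theorem greenGen4_four_sub_three_mul_two : (greenGen4 4 - 3) * greenGen4 2 = 0 := by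
  have h : Ideal.Quotient.mk greenIdeal4 (X 2 * X 4 - 3 * X 2) = 0 :=
    Ideal.Quotient.eq_zero_iff_mem.2 (Ideal.subset_span (by simp [greenRelations4]))
  rw [sub_mul, mul_comm (greenGen4 4)]
  simpa only [greenGen4, map_sub, map_mul, map_ofNat] using h

/-- The ring `ℤ[x, y]/(x² − 4x, y² − 2x − 1, (y − 3)x)` is spanned over `ℤ` by `1`, `x`, `y`. -/
theorem ring4A_eq_combination (z : Ring4A) :
    ∃ a b c : ℤ, z = a + b * Ideal.Quotient.mk ideal4A (X 0)
      + c * Ideal.Quotient.mk ideal4A (X 1) := by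
  have hxx : Ideal.Quotient.mk ideal4A (X 0 ^ 2 - 4 * X 0) = 0 :=
    Ideal.Quotient.eq_zero_iff_mem.2 (Ideal.subset_span (by simp))
  have hyy : Ideal.Quotient.mk ideal4A (X 1 ^ 2 - 2 * X 0 - 1) = 0 :=
    Ideal.Quotient.eq_zero_iff_mem.2 (Ideal.subset_span (by simp))
  have hyx : Ideal.Quotient.mk ideal4A ((X 1 - 3) * X 0) = 0 :=
    Ideal.Quotient.eq_zero_iff_mem.2 (Ideal.subset_span (by simp))
  simp only [map_sub, map_mul, map_pow, map_ofNat, map_one] at hxx hyy hyx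
  obtain ⟨p, rfl⟩ := Ideal.Quotient.mk_surjective z
  induction p using MvPolynomial.induction_on with
  | C n => exact ⟨n, 0, 0, by simp⟩
  | add p q hp hq =>
    obtain ⟨a, b, c, hp⟩ := hp
    obtain ⟨a', b', c', hq⟩ := hq
    refine ⟨a + a', b + b', c + c', ?_⟩
    rw [map_add, hp, hq]
    push_cast
    ring
  | mul_X p i hp =>
    obtain ⟨a, b, c, hp⟩ := hp
    rw [map_mul, hp]
    fin_cases i
    · refine ⟨0, a + 4 * b + 3 * c, 0, ?_⟩
      push_cast
      linear_combination (b : Ring4A) * hxx + (c : Ring4A) * hyx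
    · refine ⟨c, 3 * b + 2 * c, a, ?_⟩
      push_cast
      linear_combination (b : Ring4A) * hyx + (c : Ring4A) * hyy

/-- A ring homomorphism out of `ℤ[x, y]/(x² − 4x, y² − 2x − 1, (y − 3)x)` is determined by the
images of `x` and `y`. -/
theorem ring4A_hom_ext {R : Type*} [CommRing R] {f g : Ring4A →+* R}
    (hx : f (Ideal.Quotient.mk ideal4A (X 0)) = g (Ideal.Quotient.mk ideal4A (X 0)))
    (hy : f (Ideal.Quotient.mk ideal4A (X 1)) = g (Ideal.Quotient.mk ideal4A (X 1))) :
    f = g := by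
  refine RingHom.ext fun z => ?_
  obtain ⟨a, b, c, rfl⟩ := ring4A_eq_combination z
  simp [hx, hy]

/-- Elements satisfying the three relations determine a ring homomorphism. -/
theorem exists_ring4A_hom {R : Type*} [CommRing R] {d e : R} (hdd : d ^ 2 - 4 * d = 0)
    (hee : e ^ 2 - 2 * d - 1 = 0) (hed : (e - 3) * d = 0) :
    ∃ f : Ring4A →+* R, f (Ideal.Quotient.mk ideal4A (X 0)) = d ∧
      f (Ideal.Quotient.mk ideal4A (X 1)) = e := by
  have h : ideal4A ≤ RingHom.ker (eval₂Hom (Int.castRingHom R) ![d, e]) := by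
    refine Ideal.span_le.2 ?_
    rintro p (rfl | rfl | rfl) <;> simpa
  exact ⟨Ideal.Quotient.lift ideal4A (eval₂Hom (Int.castRingHom R) ![d, e]) fun _ hp =>
    RingHom.mem_ker.1 (h hp), by simp, by simp⟩

/-- **The 4A subring of the Green ring of `ℤ[ℤ/4ℤ]`.**
The ring homomorphism `ℤ[x,y]/(x²−4x, y²−2x−1, (y−3)x) → GreenRing4` determined by
`x ↦ D` and `y ↦ C^A` is well defined (and unique), injective, and its image is the
subring generated by `D` and `C^A`. -/
theorem ring4A_embeds_in_greenRing4 :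
    ∃ f : Ring4A →+* GreenRing4,
      f (Ideal.Quotient.mk ideal4A (X 0)) = greenGen4 2 ∧
      f (Ideal.Quotient.mk ideal4A (X 1)) = greenGen4 4 ∧
      Function.Injective f ∧
      f.range = Subring.closure {greenGen4 2, greenGen4 4} ∧
      ∀ g : Ring4A →+* GreenRing4,
        g (Ideal.Quotient.mk ideal4A (X 0)) = greenGen4 2 →
        g (Ideal.Quotient.mk ideal4A (X 1)) = greenGen4 4 → g = f := by
  obtain ⟨f, hx, hy⟩ := exists_ring4A_hom greenGen4_two_sq greenGen4_four_sq
    greenGen4_four_sub_three_mul_two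
  refine ⟨f, hx, hy, ?_, ?_, fun g hgx hgy =>
    ring4A_hom_ext (hgx.trans hx.symm) (hgy.trans hy.symm)⟩
  · refine (injective_iff_map_eq_zero f).2 fun z hz => ?_
    obtain ⟨a, b, c, rfl⟩ := ring4A_eq_combination z
    simp only [map_add, map_mul, map_intCast, hx, hy] at hz
    obtain ⟨rfl, rfl, rfl⟩ := greenGen4_combination_eq_zero hz
    simp
  · refine le_antisymm ?_ (Subring.closure_le.2 ?_)
    · rintro _ ⟨z, rfl⟩
      obtain ⟨a, b, c, rfl⟩ := ring4A_eq_combination z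
      simp only [map_add, map_mul, map_intCast, hx, hy]
      have hd : greenGen4 2 ∈ Subring.closure {greenGen4 2, greenGen4 4} :=
        Subring.subset_closure (by simp)
      have he : greenGen4 4 ∈ Subring.closure {greenGen4 2, greenGen4 4} :=
        Subring.subset_closure (by simp)
      exact add_mem (add_mem (intCast_mem _ a) (mul_mem (intCast_mem _ b) hd))
        (mul_mem (intCast_mem _ c) he)
    · rintro _ (rfl | rfl)
      · exact ⟨_, hx⟩
      · exact ⟨_, hy⟩
end

section
/- A map φ : ℤ[b,d,e]/(b²−1, (b−1)d, d²−4d, (b−1)e, (e−2)d, (e−2)e) → ℂ is a ring homomorphism if and only if (φ(b), φ(d), φ(e)) is one of the four triples (1,4,2), (1,0,2), (1,0,0), (−1,0,0). In particular there are exactly four ring homomorphisms from ℤ[b,d,e]/(b²−1, (b−1)d, d²−4d, (b−1)e, (e−2)d, (e−2)e) to ℂ, and all of them take values in the integers. -/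
open MvPolynomial

/-- The ideal `(b² − 1, (b − 1)d, d² − 4d, (b − 1)e, (e − 2)d, (e − 2)e)` of `ℤ[b, d, e]`,
with `b = X 0`, `d = X 1`, `e = X 2`.  The quotient is the subring of the Green ring of
`ℤ[ℤ/4ℤ]` generated by the classes of the sign module `B`, the group ring `D` and the
module `E`, arising from the 4B decomposition of `V^♮_ℤ` when the class `B` appears. -/
noncomputable def ideal4B' : Ideal (MvPolynomial (Fin 3) ℤ) :=
  Ideal.span {X 0 ^ 2 - 1, (X 0 - 1) * X 1, X 1 ^ 2 - 4 * X 1,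
    (X 0 - 1) * X 2, (X 2 - 2) * X 1, (X 2 - 2) * X 2}

/-- The ring `ℤ[b, d, e]/(b² − 1, (b − 1)d, d² − 4d, (b − 1)e, (e − 2)d, (e − 2)e)`. -/
noncomputable abbrev Ring4B' : Type :=
  MvPolynomial (Fin 3) ℤ ⧸ ideal4B'

namespace Ring4B'

theorem ringHom_ext {R : Type*} [CommRing R] {φ ψ : Ring4B' →+* R}
    (h : ∀ i, φ (Ideal.Quotient.mk ideal4B' (X i)) = ψ (Ideal.Quotient.mk ideal4B' (X i))) :
    φ = ψ :=
  Ideal.Quotient.ringHom_ext (MvPolynomial.ringHom_ext (fun n => by simp) h)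

/-- The values of a ring homomorphism on `b`, `d`, `e` satisfy the defining relations. -/
theorem map_relations {R : Type*} [CommRing R] (φ : Ring4B' →+* R) :
    let b := φ (Ideal.Quotient.mk ideal4B' (X 0))
    let d := φ (Ideal.Quotient.mk ideal4B' (X 1))
    let e := φ (Ideal.Quotient.mk ideal4B' (X 2))
    b ^ 2 - 1 = 0 ∧ (b - 1) * d = 0 ∧ d ^ 2 - 4 * d = 0 ∧
      (b - 1) * e = 0 ∧ (e - 2) * d = 0 ∧ (e - 2) * e = 0 := by
  have key : ∀ p ∈ ({X 0 ^ 2 - 1, (X 0 - 1) * X 1, X 1 ^ 2 - 4 * X 1,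
      (X 0 - 1) * X 2, (X 2 - 2) * X 1, (X 2 - 2) * X 2} : Set (MvPolynomial (Fin 3) ℤ)),
      φ (Ideal.Quotient.mk ideal4B' p) = 0 := fun p hp => by
    have hp' : p ∈ ideal4B' := Ideal.subset_span hp
    rw [Ideal.Quotient.eq_zero_iff_mem.mpr hp', map_zero]
  have hn (n : ℕ) [n.AtLeastTwo] :
      φ (Ideal.Quotient.mk ideal4B' (OfNat.ofNat n)) = OfNat.ofNat n :=
    map_ofNat (φ.comp (Ideal.Quotient.mk ideal4B')) n
  simpa [hn] using key

/-- A solution of the defining relations gives a ring homomorphism. -/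
theorem exists_ringHom {R : Type*} [CommRing R] (b d e : R)
    (hb : b ^ 2 - 1 = 0) (hbd : (b - 1) * d = 0) (hd : d ^ 2 - 4 * d = 0)
    (hbe : (b - 1) * e = 0) (hed : (e - 2) * d = 0) (he : (e - 2) * e = 0) :
    ∃ φ : Ring4B' →+* R, φ (Ideal.Quotient.mk ideal4B' (X 0)) = b ∧
      φ (Ideal.Quotient.mk ideal4B' (X 1)) = d ∧ φ (Ideal.Quotient.mk ideal4B' (X 2)) = e := by
  let f : MvPolynomial (Fin 3) ℤ →+* R := eval₂Hom (Int.castRingHom R) ![b, d, e]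
  have hf : ideal4B' ≤ RingHom.ker f := by
    refine Ideal.span_le.mpr ?_
    rintro p (rfl | rfl | rfl | rfl | rfl | rfl) <;>
      simpa [f, RingHom.mem_ker, -mul_eq_zero]
  refine ⟨Ideal.Quotient.lift ideal4B' f fun p hp => RingHom.mem_ker.mp (hf hp), ?_, ?_, ?_⟩ <;>
    rw [Ideal.Quotient.lift_mk] <;> simp [f]

/-- The four solutions of the defining relations over a domain. -/
theorem relations_solutions {R : Type*} [CommRing R] [IsDomain R] {b d e : R}
    (hb : b ^ 2 - 1 = 0) (hbd : (b - 1) * d = 0) (hd : d ^ 2 - 4 * d = 0)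
    (hbe : (b - 1) * e = 0) (hed : (e - 2) * d = 0) (he : (e - 2) * e = 0) :
    (b, d, e) ∈ ({(1, 4, 2), (1, 0, 2), (1, 0, 0), (-1, 0, 0)} : Set (R × R × R)) := by
  simp only [Set.mem_insert_iff, Set.mem_singleton_iff, Prod.mk.injEq]
  have hb' : (b - 1) * (b + 1) = 0 := by linear_combination hb
  have hd' : (d - 4) * d = 0 := by linear_combination hd
  rw [mul_eq_zero] at hb' hd' hbd hbe hed he
  grind

/-- Each of the four triples is the image of `(b, d, e)` under a homomorphism to `ℤ`. -/
theorem exists_ringHom_int {t : ℂ × ℂ × ℂ}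
    (ht : t ∈ ({(1, 4, 2), (1, 0, 2), (1, 0, 0), (-1, 0, 0)} : Set (ℂ × ℂ × ℂ))) :
    ∃ ψ : Ring4B' →+* ℤ, ((ψ (Ideal.Quotient.mk ideal4B' (X 0)) : ℂ),
      (ψ (Ideal.Quotient.mk ideal4B' (X 1)) : ℂ),
      (ψ (Ideal.Quotient.mk ideal4B' (X 2)) : ℂ)) = t := by
  have key (b d e : ℤ) (h : b ^ 2 - 1 = 0 ∧ (b - 1) * d = 0 ∧ d ^ 2 - 4 * d = 0 ∧
      (b - 1) * e = 0 ∧ (e - 2) * d = 0 ∧ (e - 2) * e = 0)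
      (hbde : ((b : ℂ), (d : ℂ), (e : ℂ)) = t) :
      ∃ ψ : Ring4B' →+* ℤ, ((ψ (Ideal.Quotient.mk ideal4B' (X 0)) : ℂ),
        (ψ (Ideal.Quotient.mk ideal4B' (X 1)) : ℂ),
        (ψ (Ideal.Quotient.mk ideal4B' (X 2)) : ℂ)) = t := by
    obtain ⟨hb, hbd, hd, hbe, hed, he⟩ := h
    obtain ⟨ψ, h0, h1, h2⟩ := exists_ringHom b d e hb hbd hd hbe hed he
    exact ⟨ψ, by rw [h0, h1, h2, hbde]⟩
  rcases ht with rfl | rfl | rfl | rfl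
  · exact key 1 4 2 (by norm_num) (by norm_num)
  · exact key 1 0 2 (by norm_num) (by norm_num)
  · exact key 1 0 0 (by norm_num) (by norm_num)
  · exact key (-1) 0 0 (by norm_num) (by norm_num)

theorem ringHom_ext_triple {R : Type*} [CommRing R] {φ ψ : Ring4B' →+* R}
    (h : (φ (Ideal.Quotient.mk ideal4B' (X 0)), φ (Ideal.Quotient.mk ideal4B' (X 1)),
        φ (Ideal.Quotient.mk ideal4B' (X 2))) =
      (ψ (Ideal.Quotient.mk ideal4B' (X 0)), ψ (Ideal.Quotient.mk ideal4B' (X 1)),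
        ψ (Ideal.Quotient.mk ideal4B' (X 2)))) : φ = ψ := by
  simp only [Prod.mk.injEq] at h
  exact ringHom_ext (Fin.forall_fin_succ.mpr ⟨h.1, Fin.forall_fin_two.mpr h.2⟩)

theorem map_mem_solutions (φ : Ring4B' →+* ℂ) :
    (φ (Ideal.Quotient.mk ideal4B' (X 0)), φ (Ideal.Quotient.mk ideal4B' (X 1)),
      φ (Ideal.Quotient.mk ideal4B' (X 2)))
      ∈ ({(1, 4, 2), (1, 0, 2), (1, 0, 0), (-1, 0, 0)} : Set (ℂ × ℂ × ℂ)) := by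
  obtain ⟨hb, hbd, hd, hbe, hed, he⟩ := map_relations φ
  exact relations_solutions hb hbd hd hbe hed he

end Ring4B'

/-- **Classification of ring homomorphisms
`ℤ[b,d,e]/(b²−1, (b−1)d, d²−4d, (b−1)e, (e−2)d, (e−2)e) → ℂ`.**
A map `φ` is a ring homomorphism if and only if `(φ b, φ d, φ e)` is one of `(1,4,2)`,
`(1,0,2)`, `(1,0,0)`, `(−1,0,0)`; there are exactly four such homomorphisms, each
determined by its values on `b`, `d`, `e`, and all take values in the integers. -/
theorem ring4B'_ringHom_classification :
    (∀ φ : Ring4B' →+* ℂ,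
      (φ (Ideal.Quotient.mk ideal4B' (X 0)), φ (Ideal.Quotient.mk ideal4B' (X 1)),
        φ (Ideal.Quotient.mk ideal4B' (X 2)))
        ∈ ({(1, 4, 2), (1, 0, 2), (1, 0, 0), (-1, 0, 0)} : Set (ℂ × ℂ × ℂ))) ∧
    (∀ t ∈ ({(1, 4, 2), (1, 0, 2), (1, 0, 0), (-1, 0, 0)} : Set (ℂ × ℂ × ℂ)),
      ∃! φ : Ring4B' →+* ℂ,
        (φ (Ideal.Quotient.mk ideal4B' (X 0)), φ (Ideal.Quotient.mk ideal4B' (X 1)),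
          φ (Ideal.Quotient.mk ideal4B' (X 2))) = t) ∧
    (∀ φ : Ring4B' →+* ℂ, ∀ x : Ring4B', ∃ n : ℤ, φ x = (n : ℂ)) := by
  refine ⟨Ring4B'.map_mem_solutions, fun t ht => ?_, fun φ x => ?_⟩
  · obtain ⟨ψ, hψ⟩ := Ring4B'.exists_ringHom_int ht
    exact ⟨(Int.castRingHom ℂ).comp ψ, hψ, fun φ hφ =>
      Ring4B'.ringHom_ext_triple (hφ.trans hψ.symm)⟩
  · obtain ⟨ψ, hψ⟩ := Ring4B'.exists_ringHom_int (Ring4B'.map_mem_solutions φ)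
    have h : φ = (Int.castRingHom ℂ).comp ψ := Ring4B'.ringHom_ext_triple hψ.symm
    exact ⟨ψ x, by rw [h]; rfl⟩
end

section
/- Let T be the commutative ring presented as the quotient of the polynomial ring ℤ[h₂,h₃,t,D] by the ideal generated by the elements h₂²−2h₂, h₂h₃−D, h₂t−D−h₂, h₂D−2D, h₃²−3h₃, h₃t−D−2h₃, h₃D−3D, t²−2D−h₃−1, tD−4D, D²−6D. Then a map φ : T → ℂ is a ring homomorphism if and only if (φ(h₂), φ(h₃), φ(t), φ(D)) is one of the five tuples (2,3,4,6), (0,3,2,0), (2,0,1,0), (0,0,−1,0), (0,0,1,0). In particular there are exactly five ring homomorphisms T → ℂ, and every such homomorphism takes values in the integers. -/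
open MvPolynomial

/-- The defining relations of the ring `T` encoding the tensor-product multiplication table
of the five indecomposable `ℤ[ℤ/6ℤ]`-modules `Γ₁` (the unit), `Γ(1,2) = h₂ = X 0`,
`Γ(1,3) = h₃ = X 1`, `Γ(1,2,3) = t = X 2` and `D = ℤ[ℤ/6ℤ] = X 3` that can appear in the
6A decomposition of `V^♮_ℤ`. -/
noncomputable def ideal6A : Ideal (MvPolynomial (Fin 4) ℤ) :=
  Ideal.span {X 0 ^ 2 - 2 * X 0, X 0 * X 1 - X 3, X 0 * X 2 - X 3 - X 0,
    X 0 * X 3 - 2 * X 3, X 1 ^ 2 - 3 * X 1, X 1 * X 2 - X 3 - 2 * X 1,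
    X 1 * X 3 - 3 * X 3, X 2 ^ 2 - 2 * X 3 - X 1 - 1, X 2 * X 3 - 4 * X 3,
    X 3 ^ 2 - 6 * X 3}

/-- The ring `T = ℤ[h₂,h₃,t,D]/(h₂²−2h₂, h₂h₃−D, h₂t−D−h₂, h₂D−2D, h₃²−3h₃, h₃t−D−2h₃,
h₃D−3D, t²−2D−h₃−1, tD−4D, D²−6D)`. -/
noncomputable abbrev Ring6A : Type :=
  MvPolynomial (Fin 4) ℤ ⧸ ideal6A

/-- A ring homomorphism on `ℤ[h₂,h₃,t,D]` kills `ideal6A` iff the images of the variables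
satisfy the defining relations. -/
theorem ideal6A_le_ker_iff {R : Type*} [CommRing R] (f : MvPolynomial (Fin 4) ℤ →+* R) :
    ideal6A ≤ RingHom.ker f ↔
      f (X 0) ^ 2 = 2 * f (X 0) ∧ f (X 0) * f (X 1) = f (X 3) ∧
      f (X 0) * f (X 2) = f (X 3) + f (X 0) ∧ f (X 0) * f (X 3) = 2 * f (X 3) ∧
      f (X 1) ^ 2 = 3 * f (X 1) ∧ f (X 1) * f (X 2) = f (X 3) + 2 * f (X 1) ∧
      f (X 1) * f (X 3) = 3 * f (X 3) ∧ f (X 2) ^ 2 = 2 * f (X 3) + f (X 1) + 1 ∧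
      f (X 2) * f (X 3) = 4 * f (X 3) ∧ f (X 3) ^ 2 = 6 * f (X 3) := by
  have hf (n : ℕ) [n.AtLeastTwo] : f ofNat(n) = ofNat(n) := map_ofNat f n
  simp [hf, ideal6A, Ideal.span_le, Set.insert_subset_iff, RingHom.mem_ker, sub_sub, sub_eq_zero]

/-- The solutions of the defining relations of `Ring6A` in an integral domain in which `2` and
`3` are nonzero. -/
theorem ring6A_solutions {R : Type*} [CommRing R] [IsDomain R] (h2 : (2 : R) ≠ 0)
    (h3 : (3 : R) ≠ 0) {a b c d : R} (haa : a ^ 2 = 2 * a) (hab : a * b = d)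
    (hac : a * c = d + a) (hbb : b ^ 2 = 3 * b) (hbc : b * c = d + 2 * b)
    (hcc : c ^ 2 = 2 * d + b + 1) :
    (a, b, c, d) ∈ ({(2, 3, 4, 6), (0, 3, 2, 0), (2, 0, 1, 0), (0, 0, -1, 0), (0, 0, 1, 0)} :
      Set (R × R × R × R)) := by
  subst hab
  have ha : a = 0 ∨ a = 2 := by
    have : a * (a - 2) = 0 := by linear_combination haa
    simpa [sub_eq_zero] using this
  have hb : b = 0 ∨ b = 3 := by
    have : b * (b - 3) = 0 := by linear_combination hbb
    simpa [sub_eq_zero] using this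
  rcases ha with rfl | rfl
  · rcases hb with rfl | rfl
    · have hc : c = -1 ∨ c = 1 := by
        have : (c + 1) * (c - 1) = 0 := by linear_combination hcc
        simpa [sub_eq_zero, add_eq_zero_iff_eq_neg] using this
      rcases hc with rfl | rfl <;> simp
    · obtain rfl : c = 2 := mul_left_cancel₀ h3 (by linear_combination hbc)
      simp
  · obtain rfl : c = b + 1 := mul_left_cancel₀ h2 (by linear_combination hac)
    rcases hb with rfl | rfl
    · simp
    · norm_num

/-- The values of a ring homomorphism `Ring6A → R` on the generators. -/
theorem ring6A_ringHom_apply_mem {R : Type*} [CommRing R] [IsDomain R] (h2 : (2 : R) ≠ 0)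
    (h3 : (3 : R) ≠ 0) (φ : Ring6A →+* R) :
    (φ (Ideal.Quotient.mk ideal6A (X 0)), φ (Ideal.Quotient.mk ideal6A (X 1)),
      φ (Ideal.Quotient.mk ideal6A (X 2)), φ (Ideal.Quotient.mk ideal6A (X 3)))
      ∈ ({(2, 3, 4, 6), (0, 3, 2, 0), (2, 0, 1, 0), (0, 0, -1, 0), (0, 0, 1, 0)} :
          Set (R × R × R × R)) := by
  have hker : ideal6A ≤ RingHom.ker (φ.comp (Ideal.Quotient.mk ideal6A)) := fun p hp => by
    simp [RingHom.mem_ker, Ideal.Quotient.eq_zero_iff_mem.mpr hp]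
  obtain ⟨haa, hab, hac, -, hbb, hbc, -, hcc, -, -⟩ := (ideal6A_le_ker_iff _).mp hker
  exact ring6A_solutions h2 h3 haa hab hac hbb hbc hcc

/-- Ring homomorphisms out of `Ring6A` agree if they agree on the generators. -/
theorem ring6A_ringHom_ext {R : Type*} [CommRing R] {φ ψ : Ring6A →+* R}
    (h : ∀ i, φ (Ideal.Quotient.mk ideal6A (X i)) = ψ (Ideal.Quotient.mk ideal6A (X i))) :
    φ = ψ :=
  Ideal.Quotient.ringHom_ext (MvPolynomial.ringHom_ext (fun n => by simp) h)

/-- Each of the five tuples is attained by a ring homomorphism `Ring6A → R`. -/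
theorem exists_ring6A_ringHom {R : Type*} [CommRing R] {t : R × R × R × R}
    (ht : t ∈ ({(2, 3, 4, 6), (0, 3, 2, 0), (2, 0, 1, 0), (0, 0, -1, 0), (0, 0, 1, 0)} :
      Set (R × R × R × R))) :
    ∃ φ : Ring6A →+* R,
      (φ (Ideal.Quotient.mk ideal6A (X 0)), φ (Ideal.Quotient.mk ideal6A (X 1)),
        φ (Ideal.Quotient.mk ideal6A (X 2)), φ (Ideal.Quotient.mk ideal6A (X 3))) = t := by
  obtain ⟨a, b, c, d⟩ := t
  let f : MvPolynomial (Fin 4) ℤ →+* R := eval₂Hom (Int.castRingHom R) ![a, b, c, d]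
  have hf : ideal6A ≤ RingHom.ker f := by
    simp only [Set.mem_insert_iff, Set.mem_singleton_iff, Prod.mk.injEq] at ht
    rw [ideal6A_le_ker_iff]
    rcases ht with h | h | h | h | h <;> obtain ⟨rfl, rfl, rfl, rfl⟩ := h <;> simp [f] <;>
      norm_num
  exact ⟨Ideal.Quotient.lift ideal6A f fun p hp => RingHom.mem_ker.mp (hf hp), by simp [f]⟩

/-- Every value of a ring homomorphism `Ring6A → R` is an integer. -/
theorem ring6A_ringHom_apply_eq_intCast {R : Type*} [CommRing R] [IsDomain R]
    (h2 : (2 : R) ≠ 0) (h3 : (3 : R) ≠ 0) (φ : Ring6A →+* R) (x : Ring6A) :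
    ∃ n : ℤ, φ x = n := by
  have hgen : ∀ i, ∃ n : ℤ, (n : R) = φ (Ideal.Quotient.mk ideal6A (X i)) := by
    have h := ring6A_ringHom_apply_mem h2 h3 φ
    simp only [Set.mem_insert_iff, Set.mem_singleton_iff, Prod.mk.injEq] at h
    rw [Fin.forall_fin_succ, Fin.forall_fin_succ, Fin.forall_fin_succ, Fin.forall_fin_one]
    change (∃ n : ℤ, (n : R) = φ (Ideal.Quotient.mk ideal6A (X 0))) ∧
      (∃ n : ℤ, (n : R) = φ (Ideal.Quotient.mk ideal6A (X 1))) ∧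
      (∃ n : ℤ, (n : R) = φ (Ideal.Quotient.mk ideal6A (X 2))) ∧
      (∃ n : ℤ, (n : R) = φ (Ideal.Quotient.mk ideal6A (X 3)))
    rcases h with h | h | h | h | h <;> obtain ⟨ha, hb, hc, hd⟩ := h <;>
      rw [ha, hb, hc, hd]
    exacts [⟨⟨2, by simp⟩, ⟨3, by simp⟩, ⟨4, by simp⟩, ⟨6, by simp⟩⟩,
      ⟨⟨0, by simp⟩, ⟨3, by simp⟩, ⟨2, by simp⟩, ⟨0, by simp⟩⟩,
      ⟨⟨2, by simp⟩, ⟨0, by simp⟩, ⟨1, by simp⟩, ⟨0, by simp⟩⟩,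
      ⟨⟨0, by simp⟩, ⟨0, by simp⟩, ⟨-1, by simp⟩, ⟨0, by simp⟩⟩,
      ⟨⟨0, by simp⟩, ⟨0, by simp⟩, ⟨1, by simp⟩, ⟨0, by simp⟩⟩]
  choose v hv using hgen
  obtain ⟨p, rfl⟩ := Ideal.Quotient.mk_surjective x
  have hcomp : φ.comp (Ideal.Quotient.mk ideal6A) = (Int.castRingHom R).comp (eval v) :=
    MvPolynomial.ringHom_ext (fun n => by simp) fun i => by simp [hv]
  exact ⟨eval v p, RingHom.congr_fun hcomp p⟩

/-- **Classification of ring homomorphisms from the 6A ring `T` to `ℂ`.**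
A map `φ : T → ℂ` is a ring homomorphism if and only if `(φ h₂, φ h₃, φ t, φ D)` is one of
the five tuples `(2,3,4,6)`, `(0,3,2,0)`, `(2,0,1,0)`, `(0,0,−1,0)`, `(0,0,1,0)`; there are
exactly five such homomorphisms, each determined by these values, and all take values in
the integers. -/
theorem ring6A_ringHom_classification :
    (∀ φ : Ring6A →+* ℂ,
      (φ (Ideal.Quotient.mk ideal6A (X 0)), φ (Ideal.Quotient.mk ideal6A (X 1)),
        φ (Ideal.Quotient.mk ideal6A (X 2)), φ (Ideal.Quotient.mk ideal6A (X 3)))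
        ∈ ({(2, 3, 4, 6), (0, 3, 2, 0), (2, 0, 1, 0), (0, 0, -1, 0), (0, 0, 1, 0)} :
            Set (ℂ × ℂ × ℂ × ℂ))) ∧
    (∀ t ∈ ({(2, 3, 4, 6), (0, 3, 2, 0), (2, 0, 1, 0), (0, 0, -1, 0), (0, 0, 1, 0)} :
            Set (ℂ × ℂ × ℂ × ℂ)),
      ∃! φ : Ring6A →+* ℂ,
        (φ (Ideal.Quotient.mk ideal6A (X 0)), φ (Ideal.Quotient.mk ideal6A (X 1)),
          φ (Ideal.Quotient.mk ideal6A (X 2)), φ (Ideal.Quotient.mk ideal6A (X 3))) = t) ∧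
    (∀ φ : Ring6A →+* ℂ, ∀ x : Ring6A, ∃ n : ℤ, φ x = (n : ℂ)) := by
  refine ⟨ring6A_ringHom_apply_mem two_ne_zero three_ne_zero, fun t ht => ?_,
    ring6A_ringHom_apply_eq_intCast two_ne_zero three_ne_zero⟩
  obtain ⟨φ, hφ⟩ := exists_ring6A_ringHom ht
  refine ⟨φ, hφ, fun ψ hψ => ring6A_ringHom_ext fun i => ?_⟩
  obtain ⟨h0, h1, h2, h3⟩ := by simpa only [Prod.mk.injEq] using hψ.trans hφ.symm
  fin_cases i <;> assumption
end

section
/- Let G be the cyclic group of order 4 with generator g, let D = ℤ[G] be its integral group ring regarded as a ℤ[G]-module via left multiplication, and let C be the ℤ[G]-module whose underlying group is ℤ² with g acting by g·(x,y) = (−y,x). Then the second exterior power Λ²_ℤ(ℤ[G]), equipped with the G-action induced functorially by left multiplication (g acts as Λ² of multiplication by g), is isomorphic as a ℤ[G]-module to C ⊕ ℤ[G]. -/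
/-- The cyclic group of order 4, written multiplicatively. -/
abbrev CyclicGroup4 := Multiplicative (ZMod 4)

/-- The integral group ring `ℤ[ℤ/4ℤ]`. -/
noncomputable abbrev ZG4 := MonoidAlgebra ℤ CyclicGroup4

/-- Left multiplication by the generator `g` on the group ring `ℤ[ℤ/4ℤ]`,
as a `ℤ`-linear map. -/
noncomputable def genAction4 : ZG4 →ₗ[ℤ] ZG4 :=
  LinearMap.mulLeft ℤ (MonoidAlgebra.of ℤ CyclicGroup4 (Multiplicative.ofAdd (1 : ZMod 4)))

/-- The action of the generator `g` on the module `C = ℤ²`, `g·(x, y) = (−y, x)`. -/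
noncomputable def cAction : ℤ × ℤ →ₗ[ℤ] ℤ × ℤ :=
  LinearMap.prod (-(LinearMap.snd ℤ ℤ ℤ)) (LinearMap.fst ℤ ℤ ℤ)

/-- The basis of the group ring `ℤ[ℤ/4ℤ]` given by the powers of the generator. -/
noncomputable def powBasis : Module.Basis (ZMod 4) ℤ ZG4 :=
  (MonoidAlgebra.basis CyclicGroup4 ℤ).reindex Multiplicative.toAdd

lemma coord_equivFun_symm (f : ZMod 4 → ℤ) (i : ZMod 4) :
    powBasis.coord i (powBasis.equivFun.symm f) = f i := by
  rw [Module.Basis.coord_apply, ← Module.Basis.equivFun_apply, LinearEquiv.apply_symm_apply]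

lemma coord_genAction4 (i : ZMod 4) (x : ZG4) :
    powBasis.coord i (genAction4 x) = powBasis.coord (i - 1) x := by
  suffices h : powBasis.coord i ∘ₗ genAction4 = powBasis.coord (i - 1) from
    LinearMap.congr_fun h x
  refine powBasis.ext fun j => ?_
  have h : genAction4 (powBasis j) = powBasis (1 + j) := by
    simp [powBasis, genAction4, MonoidAlgebra.single_mul_single]
  simp [h, Finsupp.single_apply, eq_sub_iff_add_eq']

/-- The alternating form `(u, v) ↦ a u * b v - a v * b u`. -/
noncomputable def minorForm {R M : Type*} [CommRing R] [AddCommGroup M] [Module R M]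
    (a b : M →ₗ[R] R) : M [⋀^Fin 2]→ₗ[R] R :=
  Matrix.detRowAlternating.compLinearMap (LinearMap.pi ![a, b])

lemma minorForm_apply {R M : Type*} [CommRing R] [AddCommGroup M] [Module R M]
    (a b : M →ₗ[R] R) (v : Fin 2 → M) :
    minorForm a b v = a (v 0) * b (v 1) - a (v 1) * b (v 0) := by
  simp only [minorForm, AlternatingMap.compLinearMap_apply]
  refine (Matrix.det_fin_two _).trans ?_
  simp [mul_comm]

/-- The linear map `⋀² ℤ[ℤ/4ℤ] → C ⊕ ℤ[ℤ/4ℤ]` recording the coordinates of a bivector along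
`1 ∧ g²` and `g ∧ g³` in the first summand, and along the `gⁱ ∧ gⁱ⁺¹` in the second. -/
noncomputable def bivectorCoords : ⋀[ℤ]^2 ZG4 →ₗ[ℤ] (ℤ × ℤ) × ZG4 :=
  exteriorPower.alternatingMapLinearEquiv
    (((minorForm (powBasis.coord 0) (powBasis.coord 2)).prod
        (minorForm (powBasis.coord 1) (powBasis.coord 3))).prod
      (powBasis.equivFun.symm.toLinearMap.compAlternatingMap
        (AlternatingMap.pi fun i => minorForm (powBasis.coord i) (powBasis.coord (i + 1)))))

lemma bivectorCoords_ιMulti (v : Fin 2 → ZG4) :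
    bivectorCoords (exteriorPower.ιMulti ℤ 2 v) =
      ((minorForm (powBasis.coord 0) (powBasis.coord 2) v,
          minorForm (powBasis.coord 1) (powBasis.coord 3) v),
        powBasis.equivFun.symm fun i =>
          minorForm (powBasis.coord i) (powBasis.coord (i + 1)) v) := by
  rw [bivectorCoords, exteriorPower.alternatingMapLinearEquiv_apply_ιMulti]
  rfl

lemma bivectorCoords_map_genAction4 (x : ⋀[ℤ]^2 ZG4) :
    bivectorCoords (exteriorPower.map 2 genAction4 x) =
      LinearMap.prodMap cAction genAction4 (bivectorCoords x) := by
  suffices h : bivectorCoords ∘ₗ exteriorPower.map 2 genAction4 =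
      LinearMap.prodMap cAction genAction4 ∘ₗ bivectorCoords from LinearMap.congr_fun h x
  ext1
  ext1 v
  simp only [LinearMap.compAlternatingMap_apply, LinearMap.comp_apply,
    exteriorPower.map_apply_ιMulti, bivectorCoords_ιMulti, LinearMap.prodMap_apply]
  refine Prod.ext (Prod.ext ?_ ?_) (powBasis.ext_elem fun j => ?_)
  · simp only [minorForm_apply, Function.comp_apply, coord_genAction4, cAction,
      LinearMap.prod_apply, Function.prod, LinearMap.neg_apply, LinearMap.snd_apply,
      show (0 - 1 : ZMod 4) = 3 by decide, show (2 - 1 : ZMod 4) = 1 by decide]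
    ring
  · simp only [minorForm_apply, Function.comp_apply, coord_genAction4, cAction,
      LinearMap.prod_apply, Function.prod, LinearMap.fst_apply,
      show (1 - 1 : ZMod 4) = 0 by decide, show (3 - 1 : ZMod 4) = 2 by decide]
  · simp only [← Module.Basis.coord_apply, minorForm_apply, Function.comp_apply,
      coord_genAction4, coord_equivFun_symm, sub_add_cancel, add_sub_cancel_right]

lemma bivectorCoords_surjective : Function.Surjective bivectorCoords := by
  rintro ⟨⟨a, b⟩, x⟩
  have coord_basis (i j : ZMod 4) : powBasis.coord i (powBasis j) = if j = i then 1 else 0 := by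
    simp [Finsupp.single_apply]
  have sum_eq (f : ZMod 4 → ℤ) : ∑ i, f i = f 0 + f 1 + f 2 + f 3 := Fin.sum_univ_four f
  refine ⟨a • exteriorPower.ιMulti ℤ 2 ![powBasis 0, powBasis 2] +
    b • exteriorPower.ιMulti ℤ 2 ![powBasis 1, powBasis 3] +
    ∑ i, powBasis.coord i x • exteriorPower.ιMulti ℤ 2 ![powBasis i, powBasis (i + 1)], ?_⟩
  simp only [map_add, map_sum, map_smul, bivectorCoords_ιMulti, minorForm_apply,
    Matrix.cons_val_zero, Matrix.cons_val_one]
  refine Prod.ext (Prod.ext ?_ ?_) (powBasis.ext_elem fun j => ?_)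
  · simp only [Prod.fst_add, Prod.smul_fst, Prod.fst_sum, coord_basis]
    simp +decide [sum_eq]
  · simp only [Prod.fst_add, Prod.snd_add, Prod.smul_fst, Prod.smul_snd, Prod.fst_sum,
      Prod.snd_sum, coord_basis]
    simp +decide [sum_eq]
  · rw [← Module.Basis.coord_apply, ← Module.Basis.coord_apply]
    simp only [Prod.snd_add, Prod.smul_snd, Prod.snd_sum, map_add, map_sum, map_smul,
      coord_equivFun_symm, coord_basis, sum_eq]
    have hj : j = 0 ∨ j = 1 ∨ j = 2 ∨ j = 3 := by decide +revert
    rcases hj with rfl | rfl | rfl | rfl <;> simp +decide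

lemma bivectorCoords_bijective : Function.Bijective bivectorCoords := by
  have hZ : Module.finrank ℤ ZG4 = 4 := by
    rw [Module.finrank_eq_nat_card_basis powBasis]
    simp
  refine OrzechProperty.bijective_of_surjective_of_finrank_le _ bivectorCoords_surjective ?_
  simp [exteriorPower.finrank_eq, hZ, Nat.choose]

/-- **`Λ²(ℤ[ℤ/4ℤ]) ≅ C ⊕ ℤ[ℤ/4ℤ]` as `ℤ[ℤ/4ℤ]`-modules.**
The functorial action of the generator `g` on the second exterior power of the group ring
`ℤ[ℤ/4ℤ]` preserves `⋀[ℤ]² ℤ[ℤ/4ℤ]`, and there is a `ℤ`-linear isomorphism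
`⋀[ℤ]² ℤ[ℤ/4ℤ] ≃ (ℤ × ℤ) × ℤ[ℤ/4ℤ]` intertwining the induced `g`-action with the
`g`-action on `C ⊕ ℤ[ℤ/4ℤ]` (where `g·(x, y) = (−y, x)` on `C = ℤ²` and `g` acts by left
multiplication on `ℤ[ℤ/4ℤ]`). -/
theorem exteriorPower_two_groupRing_Z4 :
    ∃ (h : ∀ x ∈ ⋀[ℤ]^2 ZG4, (ExteriorAlgebra.map genAction4).toLinearMap x ∈ ⋀[ℤ]^2 ZG4)
      (e : (⋀[ℤ]^2 ZG4) ≃ₗ[ℤ] (ℤ × ℤ) × ZG4),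
      ∀ x : ⋀[ℤ]^2 ZG4,
        e (((ExteriorAlgebra.map genAction4).toLinearMap.restrict h) x) =
          (LinearMap.prodMap cAction genAction4) (e x) := by
  have hmap (x : ⋀[ℤ]^2 ZG4) : (ExteriorAlgebra.map genAction4).toLinearMap x =
      exteriorPower.map 2 genAction4 x := by
    suffices h : (ExteriorAlgebra.map genAction4).toLinearMap ∘ₗ (⋀[ℤ]^2 ZG4).subtype =
        (⋀[ℤ]^2 ZG4).subtype ∘ₗ exteriorPower.map 2 genAction4 from LinearMap.congr_fun h x
    ext v
    simp only [LinearMap.compAlternatingMap_apply, LinearMap.comp_apply,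
      exteriorPower.map_apply_ιMulti, Submodule.subtype_apply, exteriorPower.ιMulti_apply_coe,
      AlgHom.toLinearMap_apply, ExteriorAlgebra.map_apply_ιMulti]
  refine ⟨fun x hx => hmap ⟨x, hx⟩ ▸ Subtype.prop _,
    LinearEquiv.ofBijective bivectorCoords bivectorCoords_bijective, fun x => ?_⟩
  rw [LinearEquiv.ofBijective_apply, LinearEquiv.ofBijective_apply,
    ← bivectorCoords_map_genAction4]
  exact congrArg _ (Subtype.ext (hmap x))
end

section
/- Let G be the cyclic group of order 4 with generator g, and let ℤ[G] be its integral group ring regarded as a ℤ[G]-module via left multiplication. Then the third exterior power Λ³_ℤ(ℤ[G]), equipped with the G-action induced functorially by left multiplication (g acts as Λ³ of multiplication by g), is isomorphic as a ℤ[G]-module to ℤ[G]. -/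
theorem exteriorPower.coe_map {R M N : Type*} [CommRing R] [AddCommGroup M] [AddCommGroup N]
    [Module R M] [Module R N] (n : ℕ) (f : M →ₗ[R] N) (x : ⋀[R]^n M) :
    (exteriorPower.map n f x : ExteriorAlgebra R N) = ExteriorAlgebra.map f x := by
  have key : (⋀[R]^n N).subtype ∘ₗ exteriorPower.map n f =
      (ExteriorAlgebra.map f).toLinearMap ∘ₗ (⋀[R]^n M).subtype := by
    apply exteriorPower.linearMap_ext
    ext v
    simp [Function.comp_def]
  exact LinearMap.congr_fun key x

/-- The basis of `ℤ[ℤ/4ℤ]` given by the group elements, indexed by `ℤ/4ℤ`. -/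
noncomputable def groupBasis4 : Module.Basis (ZMod 4) ℤ ZG4 :=
  Module.Basis.ofRepr (M := ZG4)
    ((MonoidAlgebra.coeffLinearEquiv ℤ).trans
      (Finsupp.domLCongr (Multiplicative.toAdd (α := ZMod 4))))

theorem genAction4_groupBasis4 (k : ZMod 4) :
    genAction4 (groupBasis4 k) = groupBasis4 (k + 1) := by
  have h (j : ZMod 4) : groupBasis4 j = MonoidAlgebra.single (Multiplicative.ofAdd j) 1 := by
    apply groupBasis4.repr.injective
    rw [Module.Basis.repr_self]
    simp [groupBasis4]
  simp [h, genAction4, MonoidAlgebra.single_mul_single, ← ofAdd_add, add_comm]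

/-- The `ℤ`-linear map `ℤ[ℤ/4ℤ] → ⋀³ ℤ[ℤ/4ℤ]` sending `gᵏ` to `gᵏ ∧ gᵏ⁺¹ ∧ gᵏ⁺²`. -/
noncomputable def consecutiveWedge : ZG4 →ₗ[ℤ] ⋀[ℤ]^3 ZG4 :=
  groupBasis4.constr ℤ fun k ↦
    exteriorPower.ιMulti ℤ 3 fun i : Fin 3 ↦ groupBasis4 (k + (i : ℕ))

theorem consecutiveWedge_groupBasis4 (k : ZMod 4) :
    consecutiveWedge (groupBasis4 k) =
      exteriorPower.ιMulti ℤ 3 fun i : Fin 3 ↦ groupBasis4 (k + (i : ℕ)) := by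
  simp [consecutiveWedge]

theorem consecutiveWedge_genAction4 (x : ZG4) :
    consecutiveWedge (genAction4 x) = exteriorPower.map 3 genAction4 (consecutiveWedge x) := by
  have key : consecutiveWedge ∘ₗ genAction4 =
      exteriorPower.map 3 genAction4 ∘ₗ consecutiveWedge := by
    refine groupBasis4.ext fun k ↦ ?_
    simp [genAction4_groupBasis4, consecutiveWedge_groupBasis4, Function.comp_def,
      add_right_comm]
  exact LinearMap.congr_fun key x

theorem exists_perm_eq_consecutive (a : Fin 3 → ZMod 4) (ha : Function.Injective a) :
    ∃ (k : ZMod 4) (σ : Equiv.Perm (Fin 3)), ∀ i, a i = k + ((σ i : Fin 3) : ℕ) := by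
  revert a
  decide

theorem consecutiveWedge_surjective : Function.Surjective consecutiveWedge := by
  rw [← LinearMap.range_eq_top, eq_top_iff,
    ← exteriorPower.ιMulti_span_of_span ℤ 3 ZG4 groupBasis4.span_eq, Submodule.span_le]
  rintro _ ⟨v, hv, rfl⟩
  choose a ha using fun i ↦ hv ⟨i, rfl⟩
  obtain rfl : (fun i ↦ groupBasis4 (a i)) = v := funext ha
  by_cases hinj : Function.Injective a
  · obtain ⟨k, σ, hσ⟩ := exists_perm_eq_consecutive a hinj
    have h := (exteriorPower.ιMulti ℤ 3).map_perm
      (fun i : Fin 3 ↦ groupBasis4 (k + (i : ℕ))) σ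
    rw [← consecutiveWedge_groupBasis4] at h
    simp only [Function.comp_def, ← hσ] at h
    rw [h, Units.smul_def]
    exact Submodule.smul_mem _ _ ⟨_, rfl⟩
  · rw [AlternatingMap.map_eq_zero_of_not_injective]
    · exact Submodule.zero_mem _
    · exact fun h ↦ hinj (Function.Injective.of_comp (f := groupBasis4) h)

theorem consecutiveWedge_bijective : Function.Bijective consecutiveWedge := by
  have : Module.Free ℤ ZG4 := .of_basis groupBasis4
  have : Module.Finite ℤ ZG4 := .of_basis groupBasis4
  have h4 : Module.finrank ℤ ZG4 = 4 := by simp [Module.finrank_eq_card_basis groupBasis4]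
  have h : Module.finrank ℤ ZG4 = Module.finrank ℤ (⋀[ℤ]^3 ZG4) := by
    rw [exteriorPower.finrank_eq, h4]
    rfl
  have e : ZG4 ≃ₗ[ℤ] ⋀[ℤ]^3 ZG4 := LinearEquiv.ofFinrankEq _ _ h
  exact OrzechProperty.bijective_of_surjective_of_injective e.toLinearMap consecutiveWedge
    e.injective consecutiveWedge_surjective

/-- **`Λ³(ℤ[ℤ/4ℤ]) ≅ ℤ[ℤ/4ℤ]` as `ℤ[ℤ/4ℤ]`-modules.**
The functorial action of the generator `g` on the third exterior power of the group ring
`ℤ[ℤ/4ℤ]` preserves `⋀[ℤ]³ ℤ[ℤ/4ℤ]`, and there is a `ℤ`-linear isomorphism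
`⋀[ℤ]³ ℤ[ℤ/4ℤ] ≃ ℤ[ℤ/4ℤ]` intertwining the induced `g`-action with left multiplication
by `g` on `ℤ[ℤ/4ℤ]`. -/
theorem exteriorPower_three_groupRing_Z4 :
    ∃ (h : ∀ x ∈ ⋀[ℤ]^3 ZG4, (ExteriorAlgebra.map genAction4).toLinearMap x ∈ ⋀[ℤ]^3 ZG4)
      (e : (⋀[ℤ]^3 ZG4) ≃ₗ[ℤ] ZG4),
      ∀ x : ⋀[ℤ]^3 ZG4,
        e (((ExteriorAlgebra.map genAction4).toLinearMap.restrict h) x) =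
          genAction4 (e x) := by
  refine ⟨fun x hx ↦ ?_, (LinearEquiv.ofBijective _ consecutiveWedge_bijective).symm,
    fun x ↦ ?_⟩
  · exact exteriorPower.coe_map 3 genAction4 ⟨x, hx⟩ ▸ Subtype.property _
  · obtain ⟨y, rfl⟩ := consecutiveWedge_surjective x
    rw [LinearEquiv.symm_apply_eq]
    simp only [LinearEquiv.ofBijective_symm_apply_apply]
    rw [LinearEquiv.ofBijective_apply, consecutiveWedge_genAction4]
    exact Subtype.ext (exteriorPower.coe_map 3 genAction4 _).symm
end

section
/- Let G be the cyclic group of order 6 with generator g, let M₂ = ℤ[ℤ/2ℤ] be the integral group ring of the cyclic group of order 2 regarded as a ℤ[G]-module via the surjection G → ℤ/2ℤ followed by left multiplication, and let M₃ = ℤ[ℤ/3ℤ] be the integral group ring of the cyclic group of order 3 regarded as a ℤ[G]-module via the surjection G → ℤ/3ℤ followed by left multiplication. Then the tensor product M₂ ⊗_ℤ M₃, equipped with the diagonal G-action g·(u ⊗ v) = (g·u) ⊗ (g·v), is isomorphic as a ℤ[G]-module to the group ring ℤ[G] with its left-multiplication action. -/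
open scoped TensorProduct

/-- The cyclic group of order `r`, written multiplicatively. -/
abbrev MulCyclic (r : ℕ) := Multiplicative (ZMod r)

/-- Left multiplication, on the group ring `ℤ[ℤ/rℤ]`, by the image of the generator of
`ℤ/6ℤ` under the canonical surjection `ℤ/6ℤ → ℤ/rℤ` (i.e. by the element `1` of `ℤ/rℤ`),
as a `ℤ`-linear map. -/
noncomputable def genAction (r : ℕ) :
    MonoidAlgebra ℤ (MulCyclic r) →ₗ[ℤ] MonoidAlgebra ℤ (MulCyclic r) :=
  LinearMap.mulLeft ℤ (MonoidAlgebra.of ℤ (MulCyclic r) (Multiplicative.ofAdd (1 : ZMod r)))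

/-- The Chinese remainder isomorphism for multiplicatively written cyclic groups of coprime
orders. -/
def mulCyclicProdEquiv {m n : ℕ} (h : m.Coprime n) :
    MulCyclic m × MulCyclic n ≃* MulCyclic (m * n) :=
  (MulEquiv.prodMultiplicative (ZMod m) (ZMod n)).symm.trans
    (AddEquiv.toMultiplicative (ZMod.chineseRemainder h).symm.toAddEquiv)

lemma mulCyclicProdEquiv_ofAdd_one {m n : ℕ} (h : m.Coprime n) :
    mulCyclicProdEquiv h (Multiplicative.ofAdd 1, Multiplicative.ofAdd 1) =
      Multiplicative.ofAdd 1 :=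
  congrArg Multiplicative.ofAdd (map_one (ZMod.chineseRemainder h).symm)

/-- The monoid algebra of a product is the tensor product of the monoid algebras, and left
multiplication by a pair corresponds to the tensor product of the left multiplications. -/
theorem MonoidAlgebra.exists_tensor_equiv_mulLeft_of (R : Type*) {M N P : Type*} [CommSemiring R]
    [Monoid M] [Monoid N] [Monoid P] (f : M × N ≃* P) :
    ∃ e : MonoidAlgebra R M ⊗[R] MonoidAlgebra R N ≃ₗ[R] MonoidAlgebra R P,
      ∀ a b x, e (TensorProduct.map (LinearMap.mulLeft R (of R M a))
        (LinearMap.mulLeft R (of R N b)) x) = LinearMap.mulLeft R (of R P (f (a, b))) (e x) := by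
  refine ⟨(tensorEquiv R).trans (domCongr R R f).toLinearEquiv, fun a b x ↦ ?_⟩
  induction x with
  | zero => simp only [map_zero]
  | add x y hx hy => simp only [map_add, hx, hy]
  | tmul u v =>
    induction u using MonoidAlgebra.induction_linear with
    | zero => simp only [TensorProduct.zero_tmul, map_zero]
    | add u u' hu hu' => simp only [TensorProduct.add_tmul, map_add, hu, hu']
    | single m r =>
      induction v using MonoidAlgebra.induction_linear with
      | zero => simp only [TensorProduct.tmul_zero, map_zero]
      | add v v' hv hv' => simp only [TensorProduct.tmul_add, map_add, hv, hv']
      | single n s => simp [single_mul_single, ← map_mul]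

/-- For coprime `m` and `n`, the group ring of `ℤ/mnℤ` is the tensor product of those of `ℤ/mℤ`
and `ℤ/nℤ`, as modules over a common cyclic group acting diagonally. -/
theorem exists_tensor_equiv_genAction {m n : ℕ} (h : m.Coprime n) :
    ∃ e : (MonoidAlgebra ℤ (MulCyclic m) ⊗[ℤ] MonoidAlgebra ℤ (MulCyclic n))
        ≃ₗ[ℤ] MonoidAlgebra ℤ (MulCyclic (m * n)),
      ∀ x, e (TensorProduct.map (genAction m) (genAction n) x) = genAction (m * n) (e x) := by
  obtain ⟨e, he⟩ := MonoidAlgebra.exists_tensor_equiv_mulLeft_of ℤ (mulCyclicProdEquiv h)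
  refine ⟨e, fun x ↦ ?_⟩
  rw [genAction, genAction, genAction, ← mulCyclicProdEquiv_ofAdd_one h]
  exact he _ _ x

/-- **`Γ(1,2) ⊗ Γ(1,3) ≅ D` in the Green ring of `ℤ[ℤ/6ℤ]`.**
Let `G = ℤ/6ℤ` with generator `g`, and regard `M₂ = ℤ[ℤ/2ℤ]` and `M₃ = ℤ[ℤ/3ℤ]` as
`ℤ[G]`-modules via the canonical surjections followed by left multiplication.  Then
`M₂ ⊗_ℤ M₃` with the diagonal `g`-action is isomorphic, as a `ℤ[G]`-module, to the group
ring `ℤ[ℤ/6ℤ]` with its left multiplication action: there is a `ℤ`-linear isomorphism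
intertwining the diagonal `g`-action with left multiplication by `g`. -/
theorem tensor_Z2_Z3_iso_groupRing_Z6 :
    ∃ e : (MonoidAlgebra ℤ (MulCyclic 2) ⊗[ℤ] MonoidAlgebra ℤ (MulCyclic 3))
        ≃ₗ[ℤ] MonoidAlgebra ℤ (MulCyclic 6),
      ∀ x : MonoidAlgebra ℤ (MulCyclic 2) ⊗[ℤ] MonoidAlgebra ℤ (MulCyclic 3),
        e (TensorProduct.map (genAction 2) (genAction 3) x) = genAction 6 (e x) :=
  exists_tensor_equiv_genAction (m := 2) (n := 3) (by decide)
end
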